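/- Let G₁₅ be the subgroup of G₁₁ generated by s, t and u². Then u²·s·t = s·t·u², z² = t·u²·s·t·s = t·s·t·u²·s = u²·s·t·s·t = s·t·u²·s·t = s·t·s·t·u², u⁻¹·s·u = s·t·s·t⁻¹·s⁻¹, the center of G₁₅ equals the cyclic subgroup generated by z² (which has order 12), and Z(G₁₅) = G₁₅ ∩ Z(G₁₁); moreover, with Z₁₅ = {1, z², z⁴, …, z²²}, V = {1, u²}, and X₁₅ = {1, s, s·t·s·t⁻¹·s⁻¹, s·t·s·t⁻¹, s·u², s·u²·s, s·t, s·t·s, s·t·s·t·s·t⁻¹·s⁻¹, s·t·s·t·s·t⁻¹, s·t·s·u², s·t·s·u²·s}, the map Z₁₅ × V × X₁₅ → G₁₅ sending (y, v, x) to y·v·x is a bijection onto G₁₅. -/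

import Mathlib

set_option linter.unusedSimpArgs false
open Pointwise

namespace Octa

def rels : Set (FreeGroup (Fin 3)) :=
  { FreeGroup.of 0 ^ 2, FreeGroup.of 1 ^ 3, FreeGroup.of 2 ^ 4,
    FreeGroup.of 0 * FreeGroup.of 1 * FreeGroup.of 2 *
      (FreeGroup.of 1 * FreeGroup.of 2 * FreeGroup.of 0)⁻¹,
    FreeGroup.of 0 * FreeGroup.of 1 * FreeGroup.of 2 *
      (FreeGroup.of 2 * FreeGroup.of 0 * FreeGroup.of 1)⁻¹ }

/-- The group `G₁₁ = ⟨s, t, u | s² = t³ = u⁴ = 1, stu = tus = ust⟩`. -/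
abbrev G11 := PresentedGroup rels

def s : G11 := PresentedGroup.of 0
def t : G11 := PresentedGroup.of 1
def u : G11 := PresentedGroup.of 2
def z : G11 := s * t * u

def G15 : Subgroup G11 := Subgroup.closure {s, t, u ^ 2}


theorem s_sq : s * s = 1 := by
  have h : (PresentedGroup.of 0 : G11) ^ 2 = 1 :=
    PresentedGroup.one_of_mem (rels := rels) (x := FreeGroup.of 0 ^ 2) (by simp [rels])
  rw [← pow_two]; exact h

theorem t_cube : t ^ 3 = 1 :=
  PresentedGroup.one_of_mem (rels := rels) (x := FreeGroup.of 1 ^ 3) (by simp [rels])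

theorem u_four : u ^ 4 = 1 :=
  PresentedGroup.one_of_mem (rels := rels) (x := FreeGroup.of 2 ^ 4) (by simp [rels])

theorem z_eq₁ : z = t * u * s :=
  mul_inv_eq_one.1 (PresentedGroup.one_of_mem (rels := rels)
    (x := FreeGroup.of 0 * FreeGroup.of 1 * FreeGroup.of 2 *
      (FreeGroup.of 1 * FreeGroup.of 2 * FreeGroup.of 0)⁻¹) (by simp [rels]))

theorem z_eq₂ : z = u * s * t :=
  mul_inv_eq_one.1 (PresentedGroup.one_of_mem (rels := rels)
    (x := FreeGroup.of 0 * FreeGroup.of 1 * FreeGroup.of 2 *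
      (FreeGroup.of 2 * FreeGroup.of 0 * FreeGroup.of 1)⁻¹) (by simp [rels]))

theorem comm_s : Commute s z := by
  change s * z = z * s
  conv_lhs => rw [z_eq₁]
  simp only [z, mul_assoc]

theorem comm_t : Commute t z := by
  change t * z = z * t
  conv_lhs => rw [z_eq₂]
  rw [z_eq₁]; simp only [mul_assoc]

theorem comm_u : Commute u z := by
  change u * z = z * u
  conv_rhs => rw [z_eq₂]
  simp only [z, mul_assoc]

/-- Powers of the central element. -/
def E (k : ℤ) : G11 := z ^ k

theorem E_mul (a b : ℤ) (x : G11) : E a * (E b * x) = E (a + b) * x := by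
  rw [E, E, E, zpow_add, mul_assoc]
theorem E_zero (x : G11) : E 0 * x = x := by simp [E]
theorem s_E (k : ℤ) (x : G11) : s * (E k * x) = E k * (s * x) := by
  rw [← mul_assoc, ← mul_assoc, E, (comm_s.zpow_right k).eq]
theorem t_E (k : ℤ) (x : G11) : t * (E k * x) = E k * (t * x) := by
  rw [← mul_assoc, ← mul_assoc, E, (comm_t.zpow_right k).eq]
theorem T_E (k : ℤ) (x : G11) : t⁻¹ * (E k * x) = E k * (t⁻¹ * x) := by
  rw [← mul_assoc, ← mul_assoc, E, (comm_t.inv_left.zpow_right k).eq]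
theorem ss (x : G11) : s * (s * x) = x := by rw [← mul_assoc, s_sq, one_mul]
theorem tt (x : G11) : t * (t * x) = t⁻¹ * x := by
  have h : t * t = t⁻¹ := eq_inv_of_mul_eq_one_left (by rw [← t_cube, pow_succ, pow_two])
  rw [← mul_assoc, h]
theorem TT (x : G11) : t⁻¹ * (t⁻¹ * x) = t * x := by
  have h := tt (t⁻¹ * (t⁻¹ * (t⁻¹ * x)))
  have h2 := tt x
  rw [mul_inv_cancel_left, mul_inv_cancel_left] at h
  rw [← mul_right_inj t, mul_inv_cancel_left, h2]
theorem tT (x : G11) : t * (t⁻¹ * x) = x := mul_inv_cancel_left _ _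
theorem Tt (x : G11) : t⁻¹ * (t * x) = x := inv_mul_cancel_left _ _
theorem s_inv : s⁻¹ = s := inv_eq_of_mul_eq_one_left s_sq
theorem u_eq (x : G11) : u * x = E 1 * (t⁻¹ * (s * x)) := by
  have h : u = t⁻¹ * s * E 1 := by
    rw [E, zpow_one, z, mul_assoc s t u, mul_assoc, ss, inv_mul_cancel_left]
  have h' := T_E 1 (s * x)
  rw [← h', ← s_E, h, mul_assoc, mul_assoc]
theorem uuuu (x : G11) : u * (u * (u * (u * x))) = x := by
  have h : u * (u * (u * (u * x))) = u ^ 4 * x := by simp only [pow_succ, pow_zero, one_mul, mul_assoc]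
  rw [h, u_four, one_mul]

/- The rewriting system. -/
theorem r0 (x : G11) : t⁻¹ * (s * (t⁻¹ * (s * (t⁻¹ * (s * (t⁻¹ * (s * x))))))) = E (-4) * x := by
  have h := congrArg (E (-4) * ·) (uuuu x)
  simpa only [u_eq, s_E, T_E, E_mul, E_zero, Int.reduceAdd, Int.reduceNeg] using h
theorem r1 (x : G11) : s * (t * (s * (t * x))) = E 4 * (t⁻¹ * (s * (t⁻¹ * (s * x)))) := by
  have h := congrArg (E 4 * ·) (r0 (s * (t * (s * (t * x)))))
  simpa only [ss, Tt, E_mul, E_zero, Int.reduceAdd, Int.reduceNeg] using h.symm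
theorem r2 (x : G11) : s * (t⁻¹ * (s * (t⁻¹ * (s * x)))) = E (-4) * (t * (s * (t * x))) := by
  have h := congrArg (fun y => E (-4) * (s * y)) (r1 x)
  simpa only [ss, Tt, s_E, E_mul, E_zero, Int.reduceAdd, Int.reduceNeg] using h.symm
theorem r3 (x : G11) : t⁻¹ * (s * (t⁻¹ * (s * (t * x)))) = E (-4) * (s * (t * (s * (t⁻¹ * x)))) := by
  have h := congrArg (fun y => E (-4) * y) (r1 (t * x))
  simpa only [tt, E_mul, E_zero, Int.reduceAdd, Int.reduceNeg] using h.symm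
theorem r4 (x : G11) : t⁻¹ * (s * (t⁻¹ * (s * (t⁻¹ * x)))) = E (-4) * (s * (t * (s * x))) := by
  have h := congrArg (fun y => E (-4) * y) (r1 (t⁻¹ * x))
  simpa only [tT, E_mul, E_zero, Int.reduceAdd, Int.reduceNeg] using h.symm
theorem r5 (x : G11) : t * (s * (t * (s * x))) = E 4 * (s * (t⁻¹ * (s * (t⁻¹ * x)))) := by
  have h := congrArg (fun y => E 4 * (t * y)) (r4 x)
  simpa only [tT, t_E, E_mul, E_zero, Int.reduceAdd, Int.reduceNeg] using h.symm
theorem r6 (x : G11) : t * (s * (t⁻¹ * (s * (t * x)))) =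
    E (-4) * (t⁻¹ * (s * (t * (s * (t⁻¹ * x))))) := by
  have h := congrArg (fun y => t * (t * y)) (r3 x)
  simpa only [tT, tt, t_E, T_E, E_mul, E_zero, Int.reduceAdd, Int.reduceNeg] using h
theorem r7 (x : G11) : t * (s * (t⁻¹ * (s * (t⁻¹ * x)))) =
    E (-4) * (t⁻¹ * (s * (t * (s * x)))) := by
  have h := congrArg (fun y => t * (t * y)) (r4 x)
  simpa only [tT, tt, t_E, T_E, E_mul, E_zero, Int.reduceAdd, Int.reduceNeg] using h
theorem r8 (x : G11) : s * (t⁻¹ * (s * (t * (s * (t⁻¹ * x))))) =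
    E 12 * (t⁻¹ * (s * (t * (s * (t⁻¹ * (s * x)))))) := by
  have h := (r1 (s * (t⁻¹ * (s * (t⁻¹ * (s * x)))))).symm.trans
    (congrArg (fun y => s * (t * (s * y))) (r7 (s * x)))
  have h' := congrArg (fun y => E 8 * y) h
  simp only [ss, TT, s_E, t_E, r6, E_mul, E_zero, Int.reduceAdd, Int.reduceNeg] at h'
  exact h'.symm
theorem E24 : E 24 = 1 := by
  have h := (r1 (s * (t⁻¹ * (s * (t * 1))))).symm.trans
    (congrArg (fun y => s * (t * (s * y))) (r6 1))
  have h' := congrArg (fun y => E 16 * y) h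
  simp only [tT, Tt, tt, TT, ss, t_E, T_E, s_E, E_mul, E_zero, Int.reduceAdd, Int.reduceNeg,
    r1, r2, r3, r4, r5, r6, r7] at h'
  exact mul_eq_right.1 h'

theorem E_congr {a b : ℤ} (h : (24 : ℤ) ∣ a - b) : E a = E b := by
  obtain ⟨c, hc⟩ := h
  obtain rfl : a = 24 * c + b := by linarith
  have h24 : z ^ (24 : ℤ) = 1 := E24
  rw [E, E, zpow_add, zpow_mul, h24, one_zpow, one_mul]

theorem E_congr_mul {a b : ℤ} (h : (24 : ℤ) ∣ a - b) (x : G11) : E a * x = E b * x := by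
  rw [E_congr h]

theorem z_E (x : G11) : z * x = E 1 * x := by rw [E, zpow_one]

/-- The set `V`, indexed. -/
def V : Fin 2 → G11 := ![1, u ^ 2]
/-- The set `X₁₅`, indexed. -/
def X : Fin 12 → G11 :=
  ![1, s, s * t * s * t⁻¹ * s⁻¹, s * t * s * t⁻¹, s * u ^ 2, s * u ^ 2 * s, s * t, s * t * s,
    s * t * s * t * s * t⁻¹ * s⁻¹, s * t * s * t * s * t⁻¹, s * t * s * u ^ 2,
    s * t * s * u ^ 2 * s]

/-- Exponents, and indices, of the products `V i * X j * t`. -/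
def kT : Fin 12 → ℤ := ![11, 0, 2, 0, 9, 0, 11, 1, 2, 1, 10, 1]
def iT : Fin 2 → Fin 12 → Fin 2 :=
  ![![1, 0, 1, 0, 1, 1, 1, 1, 1, 1, 0, 0], ![0, 1, 0, 1, 0, 0, 0, 0, 0, 0, 1, 1]]
def jT : Fin 12 → Fin 12 := ![3, 6, 4, 7, 11, 8, 9, 0, 10, 1, 5, 2]
def jS : Fin 12 → Fin 12 := ![1, 0, 3, 2, 5, 4, 7, 6, 9, 8, 11, 10]

theorem mul_s (j : Fin 12) : X j * s = X (jS j) := by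
  refine mul_right_cancel (b := 1) ?_
  fin_cases j <;>
    simp only [X, jS, Fin.reduceFinMk, Fin.isValue, Matrix.cons_val, s_inv, mul_assoc, ss, one_mul]

theorem mul_t (i : Fin 2) (j : Fin 12) : V i * X j * t = E (2 * kT j) * (V (iT i j) * X (jT j)) := by
  refine mul_right_cancel (b := 1) ?_
  fin_cases i <;> fin_cases j <;>
    simp only [V, X, kT, iT, jT, Fin.reduceFinMk, Fin.isValue, Matrix.cons_val, s_inv, mul_assoc,
      pow_two, one_mul, u_eq, tT, Tt, tt, TT, ss, t_E, T_E, s_E, E_mul, E_zero, Int.reduceAdd,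
      Int.reduceNeg, Int.reduceMul, r1, r2, r3, r4, r5, r6, r7, r8] <;>
    first
    | (refine E_congr_mul ?_ _; decide)
    | (refine (E_zero _).symm.trans ?_; (refine E_congr_mul ?_ _; decide))

/-- The map to `S₄`. -/
def fP : Fin 3 → Equiv.Perm (Fin 4) :=
  ![Equiv.swap 0 1, Equiv.swap 1 2 * Equiv.swap 2 3,
    (Equiv.swap 1 2 * Equiv.swap 2 3)⁻¹ * Equiv.swap 0 1]

def φ : G11 →* Equiv.Perm (Fin 4) :=
  PresentedGroup.toGroup (f := fP) (by
    intro r hr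
    simp only [rels, Set.mem_insert_iff, Set.mem_singleton_iff] at hr
    rcases hr with rfl | rfl | rfl | rfl | rfl <;>
      simp only [map_mul, map_inv, map_pow, FreeGroup.lift_apply_of] <;> decide)

/-- The map to a cyclic group of order 3. -/
def fC : Fin 3 → Multiplicative (ZMod 3) := ![1, Multiplicative.ofAdd 1, 1]

def χ : G11 →* Multiplicative (ZMod 3) :=
  PresentedGroup.toGroup (f := fC) (by
    intro r hr
    simp only [rels, Set.mem_insert_iff, Set.mem_singleton_iff] at hr
    rcases hr with rfl | rfl | rfl | rfl | rfl <;>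
      simp only [map_mul, map_inv, map_pow, FreeGroup.lift_apply_of] <;> decide)

/-- A two-dimensional representation over the field with 17 elements. -/
def fM : Fin 3 → (Matrix (Fin 2) (Fin 2) (ZMod 17))ˣ :=
  ![⟨!![1, 0; 0, 16], !![1, 0; 0, 16], by decide, by decide⟩,
    ⟨!![3, 1; 4, 13], !![13, 16; 13, 3], by decide, by decide⟩,
    ⟨!![9, 2; 9, 11], !![10, 9; 15, 2], by decide, by decide⟩]

def ρ : G11 →* (Matrix (Fin 2) (Fin 2) (ZMod 17))ˣ :=
  PresentedGroup.toGroup (f := fM) (by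
    intro r hr
    simp only [rels, Set.mem_insert_iff, Set.mem_singleton_iff] at hr
    rcases hr with rfl | rfl | rfl | rfl | rfl <;>
      simp only [map_mul, map_inv, map_pow, FreeGroup.lift_apply_of] <;> decide)

theorem z2_pow_12 : (z ^ 2) ^ 12 = 1 := by
  have h24 : z ^ (24 : ℤ) = 1 := E24
  rw [← pow_mul]; exact_mod_cast h24

theorem z2_order : orderOf (z ^ 2) = 12 := by
  have h4 : (z ^ 2) ^ 4 ≠ 1 := by
    intro h
    have h' := congrArg χ h
    rw [map_one, map_pow, map_pow] at h'
    have : χ z = fC 0 * fC 1 * fC 2 := by simp [z, s, t, u, χ]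
    rw [this] at h'
    revert h'; decide
  have h6 : (z ^ 2) ^ 6 ≠ 1 := by
    intro h
    have h' := congrArg ρ h
    rw [map_one, map_pow, map_pow] at h'
    have : ρ z = fM 0 * fM 1 * fM 2 := by simp [z, s, t, u, ρ]
    rw [this] at h'
    revert h'; decide
  have hd : orderOf (z ^ 2) ∣ 12 := orderOf_dvd_of_pow_eq_one z2_pow_12
  have h4' : ¬ orderOf (z ^ 2) ∣ 4 := fun h => h4 (orderOf_dvd_iff_pow_eq_one.1 h)
  have h6' : ¬ orderOf (z ^ 2) ∣ 6 := fun h => h6 (orderOf_dvd_iff_pow_eq_one.1 h)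
  have hle := Nat.le_of_dvd (by norm_num) hd
  generalize orderOf (z ^ 2) = n at *
  interval_cases n <;> omega

/-- Images of `V` and `X` in `S₄`. -/
def XP (a b c : Equiv.Perm (Fin 4)) : Fin 12 → Equiv.Perm (Fin 4) :=
  ![1, a, a * b * a * b⁻¹ * a⁻¹, a * b * a * b⁻¹, a * c ^ 2, a * c ^ 2 * a, a * b, a * b * a,
    a * b * a * b * a * b⁻¹ * a⁻¹, a * b * a * b * a * b⁻¹, a * b * a * c ^ 2,
    a * b * a * c ^ 2 * a]
def VP : Fin 2 → Equiv.Perm (Fin 4) := ![1, fP 2 ^ 2]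

theorem φ_s : φ s = fP 0 := by simp [φ, s]
theorem φ_t : φ t = fP 1 := by simp [φ, t]
theorem φ_u : φ u = fP 2 := by simp [φ, u]
theorem φ_z : φ z = 1 := by
  rw [z, map_mul, map_mul, φ_s, φ_t, φ_u]; decide
theorem φ_E (k : ℤ) : φ (E k) = 1 := by rw [E, map_zpow, φ_z, one_zpow]
theorem φ_V (i : Fin 2) : φ (V i) = VP i := by
  fin_cases i
  · exact map_one φ
  · exact (map_pow φ u 2).trans (by rw [φ_u]; rfl)
theorem φ_X (j : Fin 12) : φ (X j) = XP (fP 0) (fP 1) (fP 2) j := by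
  rw [← φ_s, ← φ_t, ← φ_u]
  fin_cases j <;>
    simp only [X, XP, Fin.reduceFinMk, Fin.isValue, Matrix.cons_val, map_mul, map_inv, map_pow,
      map_one]

set_option maxRecDepth 100000 in
theorem perm_inj : ∀ (i i' : Fin 2) (j j' : Fin 12),
    VP i * XP (fP 0) (fP 1) (fP 2) j = VP i' * XP (fP 0) (fP 1) (fP 2) j' → i = i' ∧ j = j' := by
  decide +kernel

set_option maxRecDepth 100000 in
theorem perm_center : ∀ (i : Fin 2) (j : Fin 12),
    fP 0 * (VP i * XP (fP 0) (fP 1) (fP 2) j) = (VP i * XP (fP 0) (fP 1) (fP 2) j) * fP 0 →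
    fP 1 * (VP i * XP (fP 0) (fP 1) (fP 2) j) = (VP i * XP (fP 0) (fP 1) (fP 2) j) * fP 1 →
    i = 0 ∧ j = 0 := by
  decide +kernel

/-- The proposed normal form of elements of `G₁₅`. -/
def NF (g : G11) : Prop := ∃ (k : ℤ) (i : Fin 2) (j : Fin 12), g = E (2 * k) * (V i * X j)

theorem NF_s {g : G11} (h : NF g) : NF (g * s) := by
  obtain ⟨k, i, j, rfl⟩ := h
  exact ⟨k, i, jS j, by rw [mul_assoc, mul_assoc, mul_s]⟩

theorem NF_t {g : G11} (h : NF g) : NF (g * t) := by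
  obtain ⟨k, i, j, rfl⟩ := h
  refine ⟨k + kT j, iT i j, jT j, ?_⟩
  rw [mul_assoc, mul_t, E_mul, mul_add]

theorem E_comm (k : ℤ) (g : G11) : Commute (E k) g := by
  have hz : Commute z g := by
    have hg : g ∈ Subgroup.closure (Set.range (PresentedGroup.of (rels := rels))) := by
      rw [PresentedGroup.closure_range_of]; trivial
    induction hg using Subgroup.closure_induction with
    | mem x hx =>
      obtain ⟨i, rfl⟩ := hx
      fin_cases i
      · exact comm_s.symm
      · exact comm_t.symm
      · exact comm_u.symm
    | one => exact Commute.one_right _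
    | mul x y _ _ hx hy => exact hx.mul_right hy
    | inv x _ hx => exact hx.inv_right
  exact hz.zpow_left k

theorem u_sq : u ^ 2 = E 2 * (t * t * s * t * t * s) := by
  refine mul_right_cancel (b := 1) ?_
  simp only [mul_assoc, pow_two, u_eq, tt, s_E, T_E, E_mul, Int.reduceAdd]

theorem NF_u {g : G11} (h : NF g) : NF (g * u ^ 2) := by
  have h' := NF_s (NF_t (NF_t (NF_s (NF_t (NF_t h)))))
  obtain ⟨k, i, j, hk⟩ := h'
  refine ⟨1 + k, i, j, ?_⟩
  rw [u_sq, ← mul_assoc, ← (E_comm 2 g).eq, mul_add, mul_one, ← E_mul, ← hk]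
  simp only [mul_assoc]

theorem NF_of_mem {g : G11} (hg : g ∈ G15) : NF g := by
  have ht : t⁻¹ = t * t := by
    have := tt 1
    simpa using this.symm
  have hu : (u ^ 2)⁻¹ = u ^ 2 := inv_eq_of_mul_eq_one_left (by rw [← pow_add]; exact u_four)
  unfold G15 at hg
  induction hg using Subgroup.closure_induction_right with
  | one => exact ⟨0, 0, 0, by simp [E, V, X]⟩
  | mul_right x _ y hy h =>
    rcases hy with rfl | rfl | rfl
    exacts [NF_s h, NF_t h, NF_u h]
  | mul_inv_cancel x _ y hy h =>
    rcases hy with rfl | rfl | rfl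
    · rw [s_inv]; exact NF_s h
    · rw [ht, ← mul_assoc]; exact NF_t (NF_t h)
    · rw [hu]; exact NF_u h

theorem s_mem : s ∈ G15 := Subgroup.subset_closure (by simp)
theorem t_mem : t ∈ G15 := Subgroup.subset_closure (by simp)
theorem u_mem : u ^ 2 ∈ G15 := Subgroup.subset_closure (by simp)

theorem z_sq : z ^ 2 = s * t * s * t * u ^ 2 := by
  refine mul_right_cancel (b := 1) ?_
  simp only [mul_assoc, pow_two, z_E, u_eq, tT, Tt, tt, TT, ss, t_E, T_E, s_E, E_mul, E_zero,
    Int.reduceAdd]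

theorem z2_mem : z ^ 2 ∈ G15 := by
  rw [z_sq]
  exact G15.mul_mem (G15.mul_mem (G15.mul_mem (G15.mul_mem s_mem t_mem) s_mem) t_mem) u_mem

theorem E_two (k : ℤ) : E (2 * k) = (z ^ 2) ^ k := by
  rw [E, zpow_mul]; norm_cast

theorem V_mem (i : Fin 2) : V i ∈ G15 := by
  fin_cases i
  exacts [G15.one_mem, u_mem]

theorem X_mem (j : Fin 12) : X j ∈ G15 := by
  have hs := s_mem
  have ht := t_mem
  have hu := u_mem
  fin_cases j <;>
    simp only [X, Fin.reduceFinMk, Fin.isValue, Matrix.cons_val] <;>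
    first
    | exact G15.one_mem
    | (repeat' first | assumption | apply G15.mul_mem | apply G15.inv_mem)

theorem map_center : (Subgroup.center ↥G15).map G15.subtype = Subgroup.zpowers (z ^ 2) := by
  ext g
  constructor
  · rintro ⟨⟨g, hg⟩, hc, rfl⟩
    have hcomm : ∀ x ∈ G15, x * g = g * x := fun x hx =>
      congrArg Subtype.val (Subgroup.mem_center_iff.1 hc ⟨x, hx⟩)
    obtain ⟨k, i, j, rfl⟩ := NF_of_mem hg
    have h1 := congrArg φ (hcomm s s_mem)
    have h2 := congrArg φ (hcomm t t_mem)
    simp only [map_mul, φ_E, φ_V, φ_X, φ_s, φ_t, one_mul] at h1 h2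
    obtain ⟨rfl, rfl⟩ := perm_center i j h1 h2
    refine ⟨k, ?_⟩
    simp [E_two, V, X]
  · rintro ⟨k, rfl⟩
    refine ⟨⟨(z ^ 2) ^ k, G15.zpow_mem z2_mem k⟩, ?_, rfl⟩
    refine Subgroup.mem_center_iff.2 fun x => Subtype.ext ?_
    have := (E_comm (2 * k) x.1).eq
    rw [E_two] at this
    exact this.symm

theorem map_center' : (Subgroup.center ↥G15).map G15.subtype = G15 ⊓ Subgroup.center G11 := by
  apply le_antisymm
  · rw [map_center, Subgroup.zpowers_le]
    refine ⟨z2_mem, Subgroup.mem_center_iff.2 fun x => ?_⟩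
    have := (E_comm (2 * 1) x).eq
    rw [E_two, zpow_one] at this
    exact this.symm
  · rintro g ⟨hg, hc⟩
    exact ⟨⟨g, hg⟩, Subgroup.mem_center_iff.2 fun x =>
      Subtype.ext (Subgroup.mem_center_iff.1 hc x.1), rfl⟩

theorem Z_set : ({1, z ^ 2, z ^ 4, z ^ 6, z ^ 8, z ^ 10, z ^ 12, z ^ 14, z ^ 16, z ^ 18, z ^ 20,
    z ^ 22} : Set G11) = {y | ∃ k : ℕ, k < 12 ∧ (z ^ 2) ^ k = y} := by
  ext y
  simp only [Set.mem_insert_iff, Set.mem_singleton_iff, Set.mem_ofPred_eq, ← pow_mul]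
  constructor
  · rintro (h | h | h | h | h | h | h | h | h | h | h | h) <;> subst h
    exacts [⟨0, by simp⟩, ⟨1, by simp⟩, ⟨2, by simp⟩, ⟨3, by simp⟩, ⟨4, by simp⟩, ⟨5, by simp⟩,
      ⟨6, by simp⟩, ⟨7, by simp⟩, ⟨8, by simp⟩, ⟨9, by simp⟩, ⟨10, by simp⟩, ⟨11, by simp⟩]
  · rintro ⟨k, hk, rfl⟩
    interval_cases k <;> simp

theorem V_set : ({1, u ^ 2} : Set G11) = Set.range V := by
  simp [V, Set.pair_comm]

theorem X_set : ({1, s, s * t * s * t⁻¹ * s⁻¹, s * t * s * t⁻¹, s * u ^ 2, s * u ^ 2 * s, s * t, s * t * s, s * t * s * t * s * t⁻¹ * s⁻¹, s * t * s * t * s * t⁻¹, s * t * s * u ^ 2, s * t * s * u ^ 2 * s} : Set G11) = Set.range X := by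
  simp only [X, Matrix.range_cons, Matrix.range_empty, Set.union_empty, Set.singleton_union]

theorem bij : Set.BijOn (fun p : G11 × G11 × G11 => p.1 * p.2.1 * p.2.2)
    ({y | ∃ k : ℕ, k < 12 ∧ (z ^ 2) ^ k = y} ×ˢ (Set.range V ×ˢ Set.range X)) (G15 : Set G11) := by
  refine ⟨?_, ?_, ?_⟩
  · rintro ⟨_, _, _⟩ ⟨⟨k, _, rfl⟩, ⟨i, rfl⟩, ⟨j, rfl⟩⟩
    exact G15.mul_mem (G15.mul_mem (G15.pow_mem z2_mem k) (V_mem i)) (X_mem j)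
  · rintro ⟨_, _, _⟩ ⟨⟨k, hk, rfl⟩, ⟨i, rfl⟩, ⟨j, rfl⟩⟩ ⟨_, _, _⟩ ⟨⟨k', hk', rfl⟩, ⟨i', rfl⟩, ⟨j', rfl⟩⟩ h
    have h : (z ^ 2) ^ k * V i * X j = (z ^ 2) ^ k' * V i' * X j' := h
    have h1 := congrArg φ h
    simp only [map_mul, map_pow, φ_z, φ_V, φ_X, one_pow, one_mul] at h1
    obtain ⟨rfl, rfl⟩ := perm_inj _ _ _ _ h1
    rw [mul_right_cancel (mul_right_cancel h)]
  · intro g hg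
    obtain ⟨k, i, j, rfl⟩ := NF_of_mem hg
    refine ⟨((z ^ 2) ^ (k % 12).toNat, V i, X j), ⟨⟨_, by omega, rfl⟩, ⟨i, rfl⟩, ⟨j, rfl⟩⟩, ?_⟩
    have : (z ^ 2) ^ (k % 12).toNat = E (2 * k) := by
      rw [← zpow_natCast, Int.toNat_of_nonneg (by omega), ← E_two]
      exact E_congr (by omega)
    simp only [this, mul_assoc]

theorem idents :
    u ^ 2 * s * t = s * t * u ^ 2 ∧
    z ^ 2 = t * u ^ 2 * s * t * s ∧
    z ^ 2 = t * s * t * u ^ 2 * s ∧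
    z ^ 2 = u ^ 2 * s * t * s * t ∧
    z ^ 2 = s * t * u ^ 2 * s * t ∧
    u⁻¹ * s * u = s * t * s * t⁻¹ * s⁻¹ := by
  rw [mul_assoc u⁻¹, inv_mul_eq_iff_eq_mul]
  refine ⟨?_, ?_, ?_, ?_, ?_, ?_⟩ <;> refine mul_right_cancel (b := 1) ?_ <;>
    simp only [mul_assoc, pow_two, s_inv, z_E, u_eq, tT, Tt, tt, TT, ss, t_E, T_E, s_E, E_mul,
      E_zero, Int.reduceAdd, Int.reduceNeg, r1, r2, r3, r4, r5, r6, r7, r8]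

theorem statement14 :
    u ^ 2 * s * t = s * t * u ^ 2 ∧
    z ^ 2 = t * u ^ 2 * s * t * s ∧
    z ^ 2 = t * s * t * u ^ 2 * s ∧
    z ^ 2 = u ^ 2 * s * t * s * t ∧
    z ^ 2 = s * t * u ^ 2 * s * t ∧
    z ^ 2 = s * t * s * t * u ^ 2 ∧
    u⁻¹ * s * u = s * t * s * t⁻¹ * s⁻¹ ∧
    orderOf (z ^ 2) = 12 ∧
    (Subgroup.center ↥G15).map G15.subtype = Subgroup.zpowers (z ^ 2) ∧
    (Subgroup.center ↥G15).map G15.subtype = G15 ⊓ Subgroup.center G11 ∧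
    Set.BijOn (fun p : G11 × G11 × G11 => p.1 * p.2.1 * p.2.2)
      (({1, z ^ 2, z ^ 4, z ^ 6, z ^ 8, z ^ 10, z ^ 12, z ^ 14, z ^ 16, z ^ 18, z ^ 20, z ^ 22} : Set G11) ×ˢ (({1, u ^ 2} : Set G11) ×ˢ ({1, s, s * t * s * t⁻¹ * s⁻¹, s * t * s * t⁻¹, s * u ^ 2, s * u ^ 2 * s, s * t, s * t * s, s * t * s * t * s * t⁻¹ * s⁻¹, s * t * s * t * s * t⁻¹, s * t * s * u ^ 2, s * t * s * u ^ 2 * s} : Set G11)))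
      (G15 : Set G11) := by
  obtain ⟨h1, h2, h3, h4, h5, h6⟩ := idents
  rw [Z_set, V_set, X_set]
  exact ⟨h1, h2, h3, h4, h5, z_sq, h6, z2_order, map_center, map_center', bij⟩

end Octa
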